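/- arXiv:2503.23648 — 3 statements merged into one kernel-verified Lean document; each statement's English description precedes it below -/
import Mathlib

section
/- If the pair (t,u) of nonnegative integers is n-feasible, then the pair (2t, t+2u) is (n+1)-feasible. -/
/-- The number of spanning trees of a finite simple graph `G`: the number of
subgraphs `T ≤ G` (on the same vertex set) that are trees. -/
noncomputable def numSpanningTrees {V : Type} [Fintype V] (G : SimpleGraph V) : ℕ :=
  Set.ncard {T : SimpleGraph V | T ≤ G ∧ T.IsTree}

/-- A pair `(t, u)` of nonnegative integers is `n`-feasible if there is a simple graph `G`
on at most `n` vertices with an edge `e` such that `t` is the number of spanning trees of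
`G` containing `e` and `u` is the number of spanning trees of `G` not containing `e`. -/
def EdgeFeasible (n t u : ℕ) : Prop :=
  ∃ (m : ℕ) (G : SimpleGraph (Fin m)) (e : Sym2 (Fin m)),
    m ≤ n ∧ e ∈ G.edgeSet ∧
    t = Set.ncard {T : SimpleGraph (Fin m) | T ≤ G ∧ T.IsTree ∧ e ∈ T.edgeSet} ∧
    u = Set.ncard {T : SimpleGraph (Fin m) | T ≤ G ∧ T.IsTree ∧ e ∉ T.edgeSet}

namespace SimpleGraph

theorem reachable_map_of_forall_adj {V W : Type*} {G : SimpleGraph V} {H : SimpleGraph W}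
    (g : V → W) (h : ∀ x y, G.Adj x y → H.Reachable (g x) (g y)) {x y : V}
    (hxy : G.Reachable x y) : H.Reachable (g x) (g y) := by
  obtain ⟨p⟩ := hxy
  induction p with
  | nil => rfl
  | cons hadj _ ih => exact (h _ _ hadj).trans ih

theorem natCard_edgeSet_map {V W : Type*} (f : V ↪ W) (G : SimpleGraph V) :
    Nat.card (G.map f).edgeSet = Nat.card G.edgeSet := by
  rw [edgeSet_map]
  exact Nat.card_image_of_injective f.sym2Map.injective _

theorem natCard_edgeSet_sup_edge {V : Type*} [Finite V] {G : SimpleGraph V} {s t : V}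
    (hn : ¬ G.Adj s t) (h : s ≠ t) :
    Nat.card (G ⊔ edge s t).edgeSet = Nat.card G.edgeSet + 1 := by
  classical
  have := Fintype.ofFinite V
  simp only [Nat.card_eq_fintype_card, ← edgeFinset_card]
  exact G.card_edgeFinset_sup_edge hn h

variable {m : ℕ}

/-- The graph obtained from `T` by adding a new vertex joined to `a` and `b` (which may be
equal, in which case the new vertex is a leaf). -/
def attach (T : SimpleGraph (Fin m)) (a b : Fin m) : SimpleGraph (Fin (m + 1)) :=
  T.map Fin.castSuccEmb ⊔ edge (Fin.last m) a.castSucc ⊔ edge (Fin.last m) b.castSucc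

variable {T G : SimpleGraph (Fin m)} {a b c d : Fin m}

theorem map_castSuccEmb_adj_castSucc {x y : Fin m} :
    (T.map Fin.castSuccEmb).Adj x.castSucc y.castSucc ↔ T.Adj x y :=
  map_adj_apply (f := Fin.castSuccEmb)

theorem not_map_castSuccEmb_adj_last {x : Fin (m + 1)} :
    ¬ (T.map Fin.castSuccEmb).Adj (Fin.last m) x := by
  rw [map_adj]
  rintro ⟨u, v, -, hu, -⟩
  exact Fin.castSucc_ne_last u hu

@[simp]
theorem attach_adj_castSucc {x y : Fin m} :
    (T.attach a b).Adj x.castSucc y.castSucc ↔ T.Adj x y := by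
  rw [attach, sup_adj, sup_adj, map_castSuccEmb_adj_castSucc]
  simp [edge_adj, Fin.castSucc_ne_last]

@[simp]
theorem attach_adj_last {x : Fin m} :
    (T.attach a b).Adj (Fin.last m) x.castSucc ↔ x = a ∨ x = b := by
  simp [attach, -Fin.coe_castSuccEmb, -map_adj, not_map_castSuccEmb_adj_last, edge_adj,
    (Fin.castSucc_ne_last _).symm]

@[simp]
theorem comap_attach : (T.attach a b).comap Fin.castSucc = T := by
  ext x y
  simp

theorem le_iff_comap_castSucc {H K : SimpleGraph (Fin (m + 1))} :
    H ≤ K ↔ H.comap Fin.castSucc ≤ K.comap Fin.castSucc ∧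
      ∀ x : Fin m, H.Adj (Fin.last m) x.castSucc → K.Adj (Fin.last m) x.castSucc := by
  refine ⟨fun h => ⟨fun _ _ hxy => h hxy, fun _ hx => h hx⟩, fun ⟨h₁, h₂⟩ x y hxy => ?_⟩
  induction x using Fin.lastCases with
  | last =>
    induction y using Fin.lastCases with
    | last => exact (H.irrefl hxy).elim
    | cast y => exact h₂ y hxy
  | cast x =>
    induction y using Fin.lastCases with
    | last => exact (h₂ x hxy.symm).symm
    | cast y => exact h₁ hxy

theorem eq_attach_iff {H : SimpleGraph (Fin (m + 1))} :
    H = T.attach a b ↔ H.comap Fin.castSucc = T ∧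
      ∀ x : Fin m, H.Adj (Fin.last m) x.castSucc ↔ x = a ∨ x = b := by
  constructor
  · rintro rfl
    simp
  · rintro ⟨rfl, h⟩
    refine le_antisymm ?_ ?_ <;> rw [le_iff_comap_castSucc] <;> simp [h]

theorem attach_le_attach (hTG : T ≤ G) (hc : c = a ∨ c = b) (hd : d = a ∨ d = b) :
    T.attach c d ≤ G.attach a b := by
  rw [le_iff_comap_castSucc]
  simp only [comap_attach, attach_adj_last]
  refine ⟨hTG, ?_⟩
  rintro x (rfl | rfl) <;> assumption

theorem attach_connected_iff : (T.attach a b).Connected ↔ (T ⊔ edge a b).Connected := by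
  have hab : (T ⊔ edge a b).Reachable a b := by
    by_cases h : a = b
    · rw [h]
    · exact Adj.reachable (by simp [edge_adj, h])
  have hla : (T.attach a b).Adj (Fin.last m) a.castSucc := by simp
  have hlb : (T.attach a b).Adj (Fin.last m) b.castSucc := by simp
  have : Nonempty (Fin m) := ⟨a⟩
  constructor
  · intro h
    refine ⟨fun x y => ?_⟩
    have key := reachable_map_of_forall_adj (H := T ⊔ edge a b)
      (Fin.lastCases (motive := fun _ => Fin m) a id) (fun x y hxy => ?_)
      (h.preconnected x.castSucc y.castSucc)
    · simpa using key
    · induction x using Fin.lastCases with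
      | last =>
        induction y using Fin.lastCases with
        | last => rfl
        | cast y => obtain rfl | rfl := attach_adj_last.1 hxy <;> simp [hab]
      | cast x =>
        induction y using Fin.lastCases with
        | last => obtain rfl | rfl := attach_adj_last.1 hxy.symm <;> simp [hab.symm]
        | cast y =>
          simpa using Adj.reachable (show (T ⊔ edge a b).Adj x y from
            Or.inl (attach_adj_castSucc.1 hxy))
  · intro h
    have hcast (x y : Fin m) : (T.attach a b).Reachable x.castSucc y.castSucc := by
      refine reachable_map_of_forall_adj Fin.castSucc (fun x y hxy => ?_) (h.preconnected x y)
      rw [sup_adj, edge_adj] at hxy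
      obtain hxy | ⟨⟨rfl, rfl⟩ | ⟨rfl, rfl⟩, -⟩ := hxy
      · exact (attach_adj_castSucc.2 hxy).reachable
      · exact hla.reachable.symm.trans hlb.reachable
      · exact hlb.reachable.symm.trans hla.reachable
    have hlast (x : Fin (m + 1)) : (T.attach a b).Reachable (Fin.last m) x := by
      induction x using Fin.lastCases with
      | last => rfl
      | cast x => exact hla.reachable.trans (hcast a x)
    exact ⟨fun x y => (hlast x).symm.trans (hlast y)⟩

theorem natCard_edgeSet_map_sup_edge :
    Nat.card (T.map Fin.castSuccEmb ⊔ edge (Fin.last m) a.castSucc).edgeSet =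
      Nat.card T.edgeSet + 1 := by
  rw [natCard_edgeSet_sup_edge not_map_castSuccEmb_adj_last (Fin.castSucc_ne_last a).symm,
    natCard_edgeSet_map]

theorem natCard_edgeSet_attach_self :
    Nat.card (T.attach a a).edgeSet = Nat.card T.edgeSet + 1 := by
  rw [attach, sup_assoc, sup_idem, natCard_edgeSet_map_sup_edge]

theorem natCard_edgeSet_attach (h : a ≠ b) :
    Nat.card (T.attach a b).edgeSet = Nat.card T.edgeSet + 2 := by
  rw [attach, natCard_edgeSet_sup_edge _ (Fin.castSucc_ne_last b).symm,
    natCard_edgeSet_map_sup_edge]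
  simp [-Fin.coe_castSuccEmb, -map_adj, not_map_castSuccEmb_adj_last, edge_adj,
    (Fin.castSucc_ne_last _).symm, h.symm]

@[simp]
theorem attach_self_isTree_iff : (T.attach a a).IsTree ↔ T.IsTree := by
  rw [isTree_iff_connected_and_card, isTree_iff_connected_and_card, attach_connected_iff,
    sup_edge_self, natCard_edgeSet_attach_self]
  simp

theorem attach_isTree_iff (h : a ≠ b) :
    (T.attach a b).IsTree ↔ ¬ T.Adj a b ∧ (T ⊔ edge a b).IsTree := by
  rw [isTree_iff_connected_and_card, isTree_iff_connected_and_card, attach_connected_iff,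
    natCard_edgeSet_attach h]
  by_cases hT : T.Adj a b
  · have hle : T ⊔ edge a b = T := sup_eq_left.2 ((edge_le_iff _).2 (Or.inr hT))
    rw [hle]
    simp only [hT, not_true_eq_false, false_and, iff_false, not_and]
    intro hc
    have := hc.card_vert_le_card_edgeSet_add_one
    simp only [Nat.card_eq_fintype_card, Fintype.card_fin] at this ⊢
    omega
  · rw [natCard_edgeSet_sup_edge hT h]
    simp [hT]

theorem attach_injective_left : Function.Injective fun T : SimpleGraph (Fin m) => T.attach a b :=
  fun _ _ h => by simpa using congrArg (SimpleGraph.comap Fin.castSucc) h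

theorem eq_attach_of_le_attach {H : SimpleGraph (Fin (m + 1))} (hH : H.Connected)
    (hle : H ≤ G.attach a b) : ∃ T ≤ G, H = T.attach a a ∨ H = T.attach b b ∨
      H = T.attach a b := by
  rw [le_iff_comap_castSucc] at hle
  simp only [comap_attach, attach_adj_last] at hle
  refine ⟨_, hle.1, ?_⟩
  have : Nontrivial (Fin (m + 1)) := ⟨_, _, Fin.castSucc_ne_last a⟩
  obtain ⟨v, hv⟩ := hH.preconnected.exists_adj_of_nontrivial (Fin.last m)
  induction v using Fin.lastCases with
  | last => exact (H.irrefl hv).elim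
  | cast v =>
    simp only [eq_attach_iff, true_and]
    grind

theorem setOf_isTree_mem_attach (hab : a ≠ b) :
    {H | H ≤ G.attach a b ∧ H.IsTree ∧ H.Adj a.castSucc b.castSucc} =
      (fun T => T.attach a a) '' {T | T ≤ G ∧ T.IsTree ∧ T.Adj a b} ∪
      (fun T => T.attach b b) '' {T | T ≤ G ∧ T.IsTree ∧ T.Adj a b} := by
  ext H
  constructor
  · rintro ⟨hle, hH, hadj⟩
    obtain ⟨T, hT, rfl | rfl | rfl⟩ := eq_attach_of_le_attach hH.connected hle
    · exact Or.inl ⟨T, ⟨hT, by simpa using hH, by simpa using hadj⟩, rfl⟩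
    · exact Or.inr ⟨T, ⟨hT, by simpa using hH, by simpa using hadj⟩, rfl⟩
    · exact (((attach_isTree_iff hab).1 hH).1 (attach_adj_castSucc.1 hadj)).elim
  · rintro (⟨T, ⟨hT, ht, hadj⟩, rfl⟩ | ⟨T, ⟨hT, ht, hadj⟩, rfl⟩)
    · exact ⟨attach_le_attach hT (by simp) (by simp), by simpa using ht, by simpa using hadj⟩
    · exact ⟨attach_le_attach hT (by simp) (by simp), by simpa using ht, by simpa using hadj⟩

theorem sdiff_edge_sup_edge (h : G.Adj a b) : G \ edge a b ⊔ edge a b = G :=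
  sdiff_sup_cancel ((edge_le_iff _).2 (Or.inr h))

theorem setOf_isTree_notMem_attach (hG : G.Adj a b) :
    {H | H ≤ G.attach a b ∧ H.IsTree ∧ ¬ H.Adj a.castSucc b.castSucc} =
      (fun T => (T \ edge a b).attach a b) '' {T | T ≤ G ∧ T.IsTree ∧ T.Adj a b} ∪
      ((fun T => T.attach a a) '' {T | T ≤ G ∧ T.IsTree ∧ ¬ T.Adj a b} ∪
      (fun T => T.attach b b) '' {T | T ≤ G ∧ T.IsTree ∧ ¬ T.Adj a b}) := by
  have hab := hG.ne
  have hedge : (edge a b).Adj a b := by simp [edge_adj, hab]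
  ext H
  constructor
  · rintro ⟨hle, hH, hadj⟩
    obtain ⟨T, hT, rfl | rfl | rfl⟩ := eq_attach_of_le_attach hH.connected hle
    · exact Or.inr (Or.inl ⟨T, ⟨hT, by simpa using hH, by simpa using hadj⟩, rfl⟩)
    · exact Or.inr (Or.inr ⟨T, ⟨hT, by simpa using hH, by simpa using hadj⟩, rfl⟩)
    · obtain ⟨hn, ht⟩ := (attach_isTree_iff hab).1 hH
      refine Or.inl ⟨T ⊔ edge a b, ⟨sup_le hT ((edge_le_iff _).2 (Or.inr hG)), ht,
        Or.inr hedge⟩, ?_⟩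
      have hdisj : Disjoint T (edge a b) := (disjoint_edge T).2 hn
      simp only [hdisj.sup_sdiff_cancel_right]
  · rintro (⟨T, ⟨hT, ht, hadj⟩, rfl⟩ | ⟨T, ⟨hT, ht, hadj⟩, rfl⟩ | ⟨T, ⟨hT, ht, hadj⟩, rfl⟩)
    · have hn : ¬ (T \ edge a b).Adj a b := fun h => h.2 hedge
      refine ⟨attach_le_attach (sdiff_le.trans hT) (by simp) (by simp),
        (attach_isTree_iff hab).2 ⟨hn, ?_⟩, by simpa using hn⟩
      rwa [sdiff_edge_sup_edge hadj]
    · exact ⟨attach_le_attach hT (by simp) (by simp), by simpa using ht, by simpa using hadj⟩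
    · exact ⟨attach_le_attach hT (by simp) (by simp), by simpa using ht, by simpa using hadj⟩

theorem disjoint_image_of_adj {V W : Type*} {F F' : SimpleGraph V → SimpleGraph W} {x y : W}
    (h : ∀ T, (F T).Adj x y) (h' : ∀ T, ¬ (F' T).Adj x y) (S S' : Set (SimpleGraph V)) :
    Disjoint (F '' S) (F' '' S') := by
  rw [Set.disjoint_left]
  rintro _ ⟨T, -, rfl⟩ ⟨T', -, hT⟩
  exact h' T' (hT ▸ h T)

theorem disjoint_image_attach_self (h : a ≠ b) (S S' : Set (SimpleGraph (Fin m))) :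
    Disjoint ((fun T => T.attach a a) '' S) ((fun T => T.attach b b) '' S') :=
  disjoint_image_of_adj (x := Fin.last m) (y := a.castSucc) (by simp) (by simp [h]) S S'

end SimpleGraph

open SimpleGraph

/-- Adding a triangle on the witness edge (keeping the witness edge): if `(t,u)` is
`n`-feasible then `(2t, t+2u)` is `(n+1)`-feasible. -/
theorem feasible_triangle (n t u : ℕ) (h : EdgeFeasible n t u) :
    EdgeFeasible (n + 1) (2 * t) (t + 2 * u) := by
  obtain ⟨m, G, e, hm, he, rfl, rfl⟩ := h
  induction e with | _ a b
  have hab : a ≠ b := G.ne_of_adj he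
  refine ⟨m + 1, G.attach a b, s(a.castSucc, b.castSucc), by omega, by simpa using he, ?_, ?_⟩
  · simp only [mem_edgeSet]
    rw [setOf_isTree_mem_attach hab,
      Set.ncard_union_eq (disjoint_image_attach_self hab _ _),
      Set.ncard_image_of_injective _ attach_injective_left,
      Set.ncard_image_of_injective _ attach_injective_left, two_mul]
  · simp only [mem_edgeSet]
    have hinj : Set.InjOn (fun T => (T \ edge a b).attach a b)
        {T | T ≤ G ∧ T.IsTree ∧ T.Adj a b} := by
      intro T hT T' hT' h
      have h' := attach_injective_left h
      rw [← sdiff_edge_sup_edge hT.2.2, h', sdiff_edge_sup_edge hT'.2.2]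
    rw [setOf_isTree_notMem_attach he, Set.ncard_union_eq, hinj.ncard_image,
      Set.ncard_union_eq (disjoint_image_attach_self hab _ _),
      Set.ncard_image_of_injective _ attach_injective_left,
      Set.ncard_image_of_injective _ attach_injective_left, two_mul]
    rw [Set.disjoint_union_right]
    exact ⟨disjoint_image_of_adj (x := Fin.last m) (y := b.castSucc) (by simp)
        (by simp [hab.symm]) _ _,
      disjoint_image_of_adj (x := Fin.last m) (y := a.castSucc) (by simp) (by simp [hab]) _ _⟩
end

section
/- If the pair (t,u) of nonnegative integers is n-feasible, then the pair (2t+u, t+u) is (n+1)-feasible. -/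
open SimpleGraph in
/-- A witness for feasibility may live on any finite vertex type. -/
lemma EdgeFeasible.of_fintype {V : Type} [Fintype V] {n : ℕ} (hn : Fintype.card V ≤ n)
    (G : SimpleGraph V) {e : Sym2 V} (he : e ∈ G.edgeSet) :
    EdgeFeasible n (Set.ncard {T : SimpleGraph V | T ≤ G ∧ T.IsTree ∧ e ∈ T.edgeSet})
      (Set.ncard {T : SimpleGraph V | T ≤ G ∧ T.IsTree ∧ e ∉ T.edgeSet}) := by
  let f : Fin (Fintype.card V) ≃ V := (Fintype.equivFin V).symm
  have hle : ∀ T : SimpleGraph V, T.comap f ≤ G.comap f ↔ T ≤ G := by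
    intro T
    refine ⟨fun h x y hxy ↦ ?_, fun h x y hxy ↦ h hxy⟩
    have := @h (f.symm x) (f.symm y)
    simp only [comap_adj, Equiv.apply_symm_apply] at this
    exact this hxy
  have htree : ∀ T : SimpleGraph V, (T.comap f).IsTree ↔ T.IsTree := fun T ↦
    (Iso.comap f T).isTree_iff
  have hmem : ∀ T : SimpleGraph V, e.map f.symm ∈ (T.comap f).edgeSet ↔ e ∈ T.edgeSet := by
    intro T
    induction e with
    | _ x y => simp
  have hinj : Function.Injective fun T : SimpleGraph V ↦ T.comap f := fun T₁ T₂ h ↦ by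
    ext x y
    simpa using congr_fun₂ (congr_arg SimpleGraph.Adj h) (f.symm x) (f.symm y)
  have hsurj : ∀ T : SimpleGraph (Fin (Fintype.card V)), (T.comap f.symm).comap f = T := by
    intro T
    ext x y
    simp
  refine ⟨Fintype.card V, G.comap f, e.map f.symm, hn, (hmem G).2 he, ?_, ?_⟩
  all_goals
    rw [← Set.ncard_image_of_injective _ hinj]
    congr 1
    ext T
    rw [← hsurj T, hinj.mem_set_image]
    simp only [Set.mem_ofPred_eq, hle, htree, hmem]

namespace SimpleGraph

variable {V : Type*}

/-- The graph obtained from `H` by adding a new vertex `none` with neighbourhood `S`. -/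
def addVertex (H : SimpleGraph V) (S : Set V) : SimpleGraph (Option V) where
  Adj
    | some x, some y => H.Adj x y
    | none, some y => y ∈ S
    | some x, none => x ∈ S
    | none, none => False
  symm := ⟨by
    rintro (_ | x) (_ | y) h
    exacts [h, h, h, H.adj_symm h]⟩
  loopless := ⟨by
    rintro (_ | x) h
    exacts [h, H.loopless.irrefl _ h]⟩

variable {H : SimpleGraph V} {S : Set V} {a b x y : V}

@[simp] lemma addVertex_adj_some_some : (H.addVertex S).Adj (some x) (some y) ↔ H.Adj x y := Iff.rfl

@[simp] lemma addVertex_adj_none_some : (H.addVertex S).Adj none (some y) ↔ y ∈ S := Iff.rfl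

@[simp] lemma addVertex_adj_some_none : (H.addVertex S).Adj (some x) none ↔ x ∈ S := Iff.rfl

lemma addVertex_le_addVertex {H' : SimpleGraph V} {S' : Set V} :
    H.addVertex S ≤ H'.addVertex S' ↔ H ≤ H' ∧ S ⊆ S' := by
  refine ⟨fun h ↦ ⟨fun x y hxy ↦ @h (some x) (some y) hxy, fun x hx ↦ @h none (some x) hx⟩, ?_⟩
  rintro ⟨hH, hS⟩ (_ | x) (_ | y) hxy
  exacts [hxy, hS hxy, hS hxy, hH hxy]

lemma addVertex_left_injective (S : Set V) :
    Function.Injective fun H : SimpleGraph V ↦ H.addVertex S := fun _ _ h ↦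
  le_antisymm (addVertex_le_addVertex.1 h.le).1 (addVertex_le_addVertex.1 h.ge).1

lemma exists_eq_addVertex (T : SimpleGraph (Option V)) :
    ∃ (H : SimpleGraph V) (S : Set V), T = H.addVertex S := by
  refine ⟨T.comap some, {x | T.Adj none (some x)}, ?_⟩
  ext (_ | x) (_ | y)
  · simp
  · simp
  · simp [T.adj_comm (some x)]
  · simp

lemma not_connected_addVertex_empty [Nonempty V] : ¬ (H.addVertex ∅).Connected := by
  intro h
  obtain ⟨x⟩ := ‹Nonempty V›
  obtain ⟨(_ | y), hy⟩ := h.preconnected.exists_adj_of_nontrivial none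
  · exact hy
  · exact hy

lemma connected_addVertex_pair :
    (H.addVertex {a, b}).Connected ↔ (H ⊔ edge a b).Connected := by
  have key : ∀ {W W' : Type _} {K : SimpleGraph W} {K' : SimpleGraph W'} (f : W → W')
      (_ : ∀ x y, K.Adj x y → K'.Reachable (f x) (f y)) {x y : W},
      K.Reachable x y → K'.Reachable (f x) (f y) := by
    rintro W W' K K' f hf x y ⟨p⟩
    induction p with
    | nil => rfl
    | cons h _ ih => exact (hf _ _ h).trans ih
  have hab : (H ⊔ edge a b).Reachable a b := by
    by_cases h : a = b
    · rw [h]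
    · exact Adj.reachable (by simp [edge_adj, h])
  have hn : ∀ x ∈ ({a, b} : Set V), (H ⊔ edge a b).Reachable a x := by
    rintro x (rfl | rfl)
    exacts [.rfl, hab]
  constructor
  · intro h
    have : Nonempty V := ⟨a⟩
    refine ⟨fun x y ↦ key (fun z : Option V ↦ z.getD a) ?_ (h.preconnected (some x) (some y))⟩
    rintro (_ | x) (_ | y) hxy
    · exact .rfl
    · exact hn _ hxy
    · exact (hn _ hxy).symm
    · exact Adj.reachable (Or.inl hxy)
  · intro h
    have ha : (H.addVertex {a, b}).Reachable (some a) none := Adj.reachable (by simp)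
    have hb : (H.addVertex {a, b}).Reachable (some b) none := Adj.reachable (by simp)
    refine (connected_iff_exists_forall_reachable _).2 ⟨none, ?_⟩
    rintro (_ | x)
    · rfl
    refine ha.symm.trans (key some ?_ (h.preconnected a x))
    rintro x y (hxy | hxy)
    · exact Adj.reachable hxy
    · rw [edge_adj] at hxy
      obtain ⟨⟨rfl, rfl⟩ | ⟨rfl, rfl⟩, -⟩ := hxy
      exacts [ha.trans hb.symm, hb.trans ha.symm]

lemma card_edgeSet_addVertex [Finite V] :
    Nat.card (H.addVertex S).edgeSet = Nat.card H.edgeSet + S.ncard := by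
  have hE : (H.addVertex S).edgeSet =
      Sym2.map some '' H.edgeSet ∪ (fun x : V ↦ s(none, some x)) '' S := by
    ext e
    induction e with
    | _ x y =>
      constructor
      · rcases x with _ | x <;> rcases y with _ | y <;> intro h
        · exact h.elim
        · exact Or.inr ⟨y, h, rfl⟩
        · exact Or.inr ⟨x, h, Sym2.eq_swap⟩
        · exact Or.inl ⟨s(x, y), h, rfl⟩
      · rintro (⟨e, he, h⟩ | ⟨z, hz, h⟩)
        · rw [← h]
          induction e with
          | _ x y => exact he
        · rw [← h]
          exact hz
  have hdisj : Disjoint (Sym2.map some '' H.edgeSet) ((fun x : V ↦ s(none, some x)) '' S) := by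
    rw [Set.disjoint_left]
    rintro _ ⟨e, -, rfl⟩ ⟨z, -, h⟩
    induction e with
    | _ x y => simp at h
  rw [Nat.card_coe_set_eq, Nat.card_coe_set_eq, hE, Set.ncard_union_eq hdisj,
    Set.ncard_image_of_injective _ (Sym2.map.injective (Option.some_injective V)),
    Set.ncard_image_of_injective]
  intro x y h
  simpa using h

lemma isTree_addVertex_singleton [Finite V] : (H.addVertex {a}).IsTree ↔ H.IsTree := by
  have h := connected_addVertex_pair (H := H) (a := a) (b := a)
  rw [Set.pair_eq_singleton, edge_self_eq_bot, sup_bot_eq] at h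
  rw [isTree_iff_connected_and_card, isTree_iff_connected_and_card, h, card_edgeSet_addVertex,
    Set.ncard_singleton, Finite.card_option, Nat.add_right_cancel_iff]

lemma isTree_addVertex_pair [Finite V] (hab : a ≠ b) :
    (H.addVertex {a, b}).IsTree ↔ (H ⊔ edge a b).IsTree ∧ ¬ H.Adj a b := by
  rw [isTree_iff_connected_and_card, isTree_iff_connected_and_card, connected_addVertex_pair,
    card_edgeSet_addVertex, Set.ncard_pair hab, Finite.card_option]
  by_cases h : H.Adj a b
  · rw [sup_eq_left.2 ((edge_le_iff _).2 (Or.inr h))]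
    simp only [h, not_true_eq_false, and_false, iff_false, not_and]
    intro hc
    have := hc.card_vert_le_card_edgeSet_add_one
    omega
  · have : Nat.card (H ⊔ edge a b).edgeSet = Nat.card H.edgeSet + 1 := by
      rw [Nat.card_coe_set_eq, Nat.card_coe_set_eq, edgeSet_sup, edgeSet_edge_of_ne hab,
        Set.union_singleton, Set.ncard_insert_of_notMem (by simpa using h)]
    rw [this]
    simp only [h, not_false_eq_true, and_true, and_congr_right_iff]
    intro
    omega

lemma ncard_isTree_sup_edge {G : SimpleGraph V} (hG : G.Adj a b) :
    Set.ncard {H : SimpleGraph V | H ≤ G ∧ (H ⊔ edge a b).IsTree ∧ ¬ H.Adj a b} =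
      Set.ncard {T : SimpleGraph V | T ≤ G ∧ T.IsTree ∧ s(a, b) ∈ T.edgeSet} := by
  have he : edge a b ≤ G := (edge_le_iff _).2 (Or.inr hG)
  have hdisj : ∀ {H : SimpleGraph V}, ¬ H.Adj a b → Disjoint H (edge a b) := by
    intro H h
    rw [disjoint_edge]
    exact h
  refine Set.ncard_congr (fun H _ ↦ H ⊔ edge a b) ?_ ?_ ?_
  · rintro H ⟨hH, ht, -⟩
    exact ⟨sup_le hH he, ht, by simp [hG.ne]⟩
  · rintro H₁ H₂ ⟨-, -, h₁⟩ ⟨-, -, h₂⟩ h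
    rw [← (hdisj h₁).sup_sdiff_cancel_right, h, (hdisj h₂).sup_sdiff_cancel_right]
  · rintro T ⟨hT, ht, hab⟩
    have hTe : T \ edge a b ⊔ edge a b = T :=
      sdiff_sup_cancel ((edge_le_iff _).2 (Or.inr hab))
    exact ⟨T \ edge a b, ⟨sdiff_le.trans hT, hTe.symm ▸ ht, by simp [edge_adj, hG.ne]⟩, hTe⟩

lemma ncard_isTree_addVertex_pair_not_mem [Finite V] {G : SimpleGraph V} (hab : a ≠ b) :
    Set.ncard {T : SimpleGraph (Option V) | T ≤ G.addVertex {a, b} ∧ T.IsTree ∧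
      s(none, some a) ∉ T.edgeSet} = Set.ncard {T : SimpleGraph V | T ≤ G ∧ T.IsTree} := by
  rw [← Set.ncard_image_of_injective _ (addVertex_left_injective {b})]
  congr 1
  ext T
  constructor
  · rintro ⟨hle, ht, ha⟩
    obtain ⟨H, S, rfl⟩ := T.exists_eq_addVertex
    rw [addVertex_le_addVertex] at hle
    rw [mem_edgeSet, addVertex_adj_none_some] at ha
    have hS : S ⊆ {b} := fun x hx ↦ (hle.2 hx).resolve_left fun h ↦ ha (h ▸ hx)
    rcases Set.subset_singleton_iff_eq.1 hS with rfl | rfl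
    · have : Nonempty V := ⟨a⟩
      exact (not_connected_addVertex_empty ht.connected).elim
    · exact ⟨H, ⟨hle.1, isTree_addVertex_singleton.1 ht⟩, rfl⟩
  · rintro ⟨H, ⟨hle, ht⟩, rfl⟩
    exact ⟨addVertex_le_addVertex.2 ⟨hle, by simp⟩, isTree_addVertex_singleton.2 ht, by simpa⟩

lemma ncard_isTree_addVertex_pair_mem [Finite V] {G : SimpleGraph V} (hab : a ≠ b) :
    Set.ncard {T : SimpleGraph (Option V) | T ≤ G.addVertex {a, b} ∧ T.IsTree ∧
      s(none, some a) ∈ T.edgeSet} = Set.ncard {T : SimpleGraph V | T ≤ G ∧ T.IsTree} +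
      Set.ncard {H : SimpleGraph V | H ≤ G ∧ (H ⊔ edge a b).IsTree ∧ ¬ H.Adj a b} := by
  rw [← Set.ncard_image_of_injective _ (addVertex_left_injective {a}),
    ← Set.ncard_image_of_injective {H | H ≤ G ∧ (H ⊔ edge a b).IsTree ∧ ¬ H.Adj a b}
      (addVertex_left_injective {a, b}), ← Set.ncard_union_eq]
  · congr 1
    ext T
    constructor
    · rintro ⟨hle, ht, ha⟩
      obtain ⟨H, S, rfl⟩ := T.exists_eq_addVertex
      rw [addVertex_le_addVertex] at hle
      rw [mem_edgeSet, addVertex_adj_none_some] at ha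
      by_cases hb : b ∈ S
      · obtain rfl : S = {a, b} := hle.2.antisymm (Set.pair_subset ha hb)
        exact Or.inr ⟨H, ⟨hle.1, (isTree_addVertex_pair hab).1 ht⟩, rfl⟩
      · obtain rfl : S = {a} := Set.Subset.antisymm
          (fun x hx ↦ (hle.2 hx).resolve_right fun h ↦ hb (h ▸ hx)) (by simpa)
        exact Or.inl ⟨H, ⟨hle.1, isTree_addVertex_singleton.1 ht⟩, rfl⟩
    · rintro (⟨H, ⟨hle, ht⟩, rfl⟩ | ⟨H, ⟨hle, ht⟩, rfl⟩)
      · exact ⟨addVertex_le_addVertex.2 ⟨hle, by simp⟩, isTree_addVertex_singleton.2 ht, by simp⟩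
      · exact ⟨addVertex_le_addVertex.2 ⟨hle, le_rfl⟩, (isTree_addVertex_pair hab).2 ht, by simp⟩
  · rw [Set.disjoint_left]
    rintro _ ⟨H₁, -, rfl⟩ ⟨H₂, -, h⟩
    have := (addVertex_le_addVertex.1 h.le).2 (Set.mem_insert_of_mem a rfl)
    exact hab (Set.mem_singleton_iff.1 this).symm

end SimpleGraph

open SimpleGraph in
lemma ncard_isTree_eq_add {V : Type*} [Finite V] (G : SimpleGraph V) (e : Sym2 V) :
    Set.ncard {T : SimpleGraph V | T ≤ G ∧ T.IsTree} =
      Set.ncard {T : SimpleGraph V | T ≤ G ∧ T.IsTree ∧ e ∈ T.edgeSet} +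
      Set.ncard {T : SimpleGraph V | T ≤ G ∧ T.IsTree ∧ e ∉ T.edgeSet} := by
  rw [← Set.ncard_union_eq (Set.disjoint_left.2 fun T h h' ↦ h'.2.2 h.2.2)]
  congr 1
  ext T
  simp only [Set.mem_ofPred_eq, Set.mem_union]
  tauto

/-- Adding a triangle on the witness edge (moving the witness edge to a new edge): if
`(t,u)` is `n`-feasible then `(2t+u, t+u)` is `(n+1)`-feasible. -/
theorem feasible_triangle' (n t u : ℕ) (h : EdgeFeasible n t u) :
    EdgeFeasible (n + 1) (2 * t + u) (t + u) := by
  obtain ⟨m, G, e, hm, he, ht, hu⟩ := h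
  have htot := ncard_isTree_eq_add G e
  rw [← ht, ← hu] at htot
  induction e with
  | _ a b =>
    have hab : a ≠ b := G.ne_of_adj he
    have := EdgeFeasible.of_fintype (n := n + 1) (by simpa using hm) (G.addVertex {a, b})
      (e := s(none, some a)) (by simp)
    rw [SimpleGraph.ncard_isTree_addVertex_pair_mem hab,
      SimpleGraph.ncard_isTree_addVertex_pair_not_mem hab,
      SimpleGraph.ncard_isTree_sup_edge he, ← ht, htot] at this
    convert this using 1
    ring
end

section
/- For every positive integer n, the set of (n+2)-feasible pairs (t,u) of nonnegative integers has cardinality at least 2^n. -/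
namespace SimpleGraph

/-- The graph on `Fin (m + 1)` obtained from `H` by shifting its vertices by one and adding
the vertex `0` with neighbourhood `N`. -/
def consVertex {m : ℕ} (H : SimpleGraph (Fin m)) (N : Set (Fin m)) :
    SimpleGraph (Fin (m + 1)) where
  Adj x y := Fin.cases (motive := fun _ => Prop)
    (Fin.cases (motive := fun _ => Prop) False (fun j => j ∈ N) y)
    (fun i => Fin.cases (motive := fun _ => Prop) (i ∈ N) (fun j => H.Adj i j) y) x
  symm := ⟨fun x y h => by
    cases x using Fin.cases <;> cases y using Fin.cases <;> simp_all [H.adj_comm]⟩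
  loopless := ⟨fun x h => by cases x using Fin.cases <;> simp_all⟩

section consVertex

variable {m : ℕ} {H K : SimpleGraph (Fin m)} {M N : Set (Fin m)} {a b : Fin m}

@[simp] lemma consVertex_adj_zero_succ {j : Fin m} :
    (H.consVertex N).Adj 0 j.succ ↔ j ∈ N := Iff.rfl

@[simp] lemma consVertex_adj_succ_zero {i : Fin m} :
    (H.consVertex N).Adj i.succ 0 ↔ i ∈ N := Iff.rfl

@[simp] lemma consVertex_adj_succ_succ {i j : Fin m} :
    (H.consVertex N).Adj i.succ j.succ ↔ H.Adj i j := Iff.rfl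

lemma consVertex_comap_succ (T : SimpleGraph (Fin (m + 1))) :
    (T.comap Fin.succ).consVertex {j | T.Adj 0 j.succ} = T := by
  ext x y
  cases x using Fin.cases <;> cases y using Fin.cases <;> simp [T.adj_comm]

lemma consVertex_le_consVertex : H.consVertex M ≤ K.consVertex N ↔ H ≤ K ∧ M ⊆ N := by
  refine ⟨fun h => ⟨fun i j hij => ?_, fun j hj => ?_⟩, fun h x y hxy => ?_⟩
  · exact @h i.succ j.succ hij
  · exact @h 0 j.succ hj
  · cases x using Fin.cases <;> cases y using Fin.cases
    · simp at hxy
    · exact h.2 hxy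
    · exact h.2 hxy
    · exact h.1 hxy

lemma consVertex_injective (N : Set (Fin m)) :
    Function.Injective fun H : SimpleGraph (Fin m) => H.consVertex N := fun _ _ h =>
  le_antisymm (consVertex_le_consVertex.1 (le_of_eq h)).1
    (consVertex_le_consVertex.1 (le_of_eq h.symm)).1

lemma edgeSet_consVertex : (H.consVertex N).edgeSet =
    Sym2.map Fin.succ '' H.edgeSet ∪ (fun j : Fin m => s(0, j.succ)) '' N := by
  ext e
  induction e with | _ x y
  cases x using Fin.cases <;> cases y using Fin.cases
  all_goals
    simp only [mem_edgeSet, Set.mem_union, Set.mem_image, Sym2.exists, Sym2.map_mk]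
    simp [Fin.succ_ne_zero, (Fin.succ_ne_zero _).symm]
  constructor
  · intro h
    exact ⟨_, _, h, Or.inl ⟨rfl, rfl⟩⟩
  · rintro ⟨x, y, h, ⟨rfl, rfl⟩ | ⟨rfl, rfl⟩⟩
    · exact h
    · exact h.symm

lemma ncard_edgeSet_consVertex :
    (H.consVertex N).edgeSet.ncard = H.edgeSet.ncard + N.ncard := by
  rw [edgeSet_consVertex, Set.ncard_union_eq,
    Set.ncard_image_of_injective _ (Sym2.map.injective (Fin.succ_injective m)),
    Set.ncard_image_of_injective]
  · intro i j h
    simpa using h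
  · rw [Set.disjoint_left]
    rintro _ ⟨e, -, rfl⟩ ⟨j, -, h⟩
    induction e with | _ x y
    simp [(Fin.succ_ne_zero _).symm] at h

lemma Reachable.of_adj_reachable {V W : Type*} {G : SimpleGraph V} {G' : SimpleGraph W}
    (f : V → W) (hf : ∀ x y, G.Adj x y → G'.Reachable (f x) (f y)) {x y : V}
    (h : G.Reachable x y) : G'.Reachable (f x) (f y) := by
  obtain ⟨p⟩ := h
  induction p with
  | nil => rfl
  | cons hadj _ ih => exact (hf _ _ hadj).trans ih

lemma connected_consVertex_pair :
    (H.consVertex {a, b}).Connected ↔ (H ⊔ edge a b).Connected := by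
  have hab : (H ⊔ edge a b).Reachable a b := by
    by_cases h : a = b
    · rw [h]
    · exact Adj.reachable (Or.inr (by simp [edge_adj, h]))
  constructor
  · intro h
    have : Nonempty (Fin m) := ⟨a⟩
    refine ⟨fun x y => ?_⟩
    refine Reachable.of_adj_reachable (Fin.cases a id : Fin (m + 1) → Fin m) ?_
      (h.preconnected x.succ y.succ)
    intro x y hxy
    cases x using Fin.cases <;> cases y using Fin.cases
    · simp at hxy
    · obtain rfl | rfl := hxy
      · rfl
      · exact hab
    · obtain rfl | rfl := hxy
      · rfl
      · exact hab.symm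
    · exact Adj.reachable (Or.inl hxy)
  · intro h
    have h₀ : ∀ j ∈ ({a, b} : Set (Fin m)), (H.consVertex {a, b}).Reachable 0 j.succ :=
      fun j hj => Adj.reachable hj
    have h₁ : ∀ x y, (H.consVertex {a, b}).Reachable (Fin.succ x) (Fin.succ y) := fun x y => by
      refine Reachable.of_adj_reachable Fin.succ ?_ (h.preconnected x y)
      rintro x y (hxy | hxy)
      · exact Adj.reachable hxy
      · rw [edge_adj] at hxy
        obtain ⟨⟨rfl, rfl⟩ | ⟨rfl, rfl⟩, -⟩ := hxy
        · exact (h₀ _ (by simp)).symm.trans (h₀ _ (by simp))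
        · exact (h₀ _ (by simp)).symm.trans (h₀ _ (by simp))
    refine ⟨fun x y => ?_⟩
    have h₂ : ∀ x, (H.consVertex {a, b}).Reachable (Fin.succ a) x := fun x => by
      cases x using Fin.cases
      · exact (h₀ a (by simp)).symm
      · exact h₁ _ _
    exact (h₂ x).symm.trans (h₂ y)

lemma isTree_iff_connected_and_ncard {V : Type*} [Finite V] {G : SimpleGraph V} :
    G.IsTree ↔ G.Connected ∧ G.edgeSet.ncard + 1 = Nat.card V :=
  isTree_iff_connected_and_card

lemma isTree_consVertex_singleton : (H.consVertex {a}).IsTree ↔ H.IsTree := by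
  have h := connected_consVertex_pair (H := H) (a := a) (b := a)
  rw [Set.pair_eq_singleton, edge_self_eq_bot, sup_bot_eq] at h
  rw [isTree_iff_connected_and_ncard, isTree_iff_connected_and_ncard, h,
    ncard_edgeSet_consVertex]
  simp

lemma isTree_consVertex_pair (hab : a ≠ b) :
    (H.consVertex {a, b}).IsTree ↔ ¬ H.Adj a b ∧ (H ⊔ edge a b).IsTree := by
  rw [isTree_iff_connected_and_ncard, isTree_iff_connected_and_ncard,
    connected_consVertex_pair, ncard_edgeSet_consVertex, Set.ncard_pair hab]
  by_cases hadj : H.Adj a b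
  · rw [sup_edge_of_adj _ hadj]
    simp only [hadj, not_true_eq_false, false_and, iff_false, not_and]
    intro hc hcard
    have := hc.card_vert_le_card_edgeSet_add_one
    rw [Nat.card_coe_set_eq] at this
    simp at this hcard
    omega
  · have : (H ⊔ edge a b).edgeSet.ncard = H.edgeSet.ncard + 1 := by
      rw [edgeSet_sup, edgeSet_edge_of_ne hab, Set.union_singleton, Set.ncard_insert_of_notMem]
      simpa using hadj
    rw [this]
    simp [hadj]

lemma not_isTree_consVertex_empty [NeZero m] : ¬ (H.consVertex ∅).IsTree := by
  intro h
  have : Nontrivial (Fin (m + 1)) := Fin.nontrivial_iff_two_le.2 (by have := NeZero.ne m; omega)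
  obtain ⟨x, hx⟩ := h.connected.preconnected.exists_adj_of_nontrivial 0
  cases x using Fin.cases <;> simp at hx

end consVertex

end SimpleGraph

open SimpleGraph

section counting

variable {m : ℕ} {a b : Fin m}

lemma ncard_not_adj_isTree_sup_edge (K : SimpleGraph (Fin m)) (hab : a ≠ b) :
    Set.ncard {H : SimpleGraph (Fin m) | H ≤ K ∧ ¬ H.Adj a b ∧ (H ⊔ edge a b).IsTree} =
      Set.ncard {T : SimpleGraph (Fin m) | T ≤ K ⊔ edge a b ∧ T.IsTree ∧ T.Adj a b} := by
  refine Set.ncard_congr (fun H _ => H ⊔ edge a b) ?_ ?_ ?_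
  · rintro H ⟨hK, -, ht⟩
    exact ⟨sup_le_sup_right hK _, ht, Or.inr (by simp [edge_adj, hab])⟩
  · rintro H H' ⟨-, h, -⟩ ⟨-, h', -⟩ heq
    have hd : ∀ {L : SimpleGraph (Fin m)}, ¬ L.Adj a b → Disjoint L (edge a b) := fun h => by
      rwa [disjoint_edge]
    simpa [(hd h).sup_sdiff_cancel_right, (hd h').sup_sdiff_cancel_right] using
      congrArg (· \ edge a b) heq
  · rintro T ⟨hK, ht, hadj⟩
    have hT : T \ edge a b ⊔ edge a b = T :=
      sdiff_sup_cancel ((edge_le_iff _).2 (Or.inr hadj))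
    refine ⟨T \ edge a b, ⟨?_, ?_, ?_⟩, hT⟩
    · rwa [sdiff_le_iff, sup_comm]
    · simp [edge_adj, hab]
    · rwa [hT]

lemma ncard_isTree_consVertex_pair_mem (K : SimpleGraph (Fin m)) (hab : a ≠ b) :
    Set.ncard {T | T ≤ K.consVertex {a, b} ∧ T.IsTree ∧ s(0, a.succ) ∈ T.edgeSet} =
      Set.ncard {T | T ≤ K ∧ T.IsTree} +
      Set.ncard {T : SimpleGraph (Fin m) | T ≤ K ⊔ edge a b ∧ T.IsTree ∧ T.Adj a b} := by
  have hset : {T | T ≤ K.consVertex {a, b} ∧ T.IsTree ∧ s(0, a.succ) ∈ T.edgeSet} =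
      (fun H : SimpleGraph (Fin m) => H.consVertex {a}) '' {T | T ≤ K ∧ T.IsTree} ∪
      (fun H : SimpleGraph (Fin m) => H.consVertex {a, b}) ''
        {H | H ≤ K ∧ ¬ H.Adj a b ∧ (H ⊔ edge a b).IsTree} := by
    ext T
    constructor
    · rintro ⟨hle, ht, he⟩
      rw [← consVertex_comap_succ T] at hle ht he
      rw [← consVertex_comap_succ T]
      generalize T.comap Fin.succ = H at *
      generalize {j : Fin m | T.Adj 0 j.succ} = N at *
      obtain ⟨hH, hN⟩ := consVertex_le_consVertex.1 hle
      have ha : a ∈ N := he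
      by_cases hb : b ∈ N
      · obtain rfl : N = {a, b} := hN.antisymm (Set.pair_subset ha hb)
        exact Or.inr ⟨H, ⟨hH, (isTree_consVertex_pair hab).1 ht⟩, rfl⟩
      · obtain rfl : N = {a} := by
          refine subset_antisymm (fun j hj => ?_) (Set.singleton_subset_iff.2 ha)
          obtain rfl | rfl := hN hj
          · rfl
          · exact absurd hj hb
        exact Or.inl ⟨H, ⟨hH, isTree_consVertex_singleton.1 ht⟩, rfl⟩
    · rintro (⟨H, ⟨hH, ht⟩, rfl⟩ | ⟨H, ⟨hH, ht⟩, rfl⟩)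
      · exact ⟨consVertex_le_consVertex.2 ⟨hH, by simp⟩, isTree_consVertex_singleton.2 ht,
          by simp⟩
      · exact ⟨consVertex_le_consVertex.2 ⟨hH, le_rfl⟩, (isTree_consVertex_pair hab).2 ht,
          by simp⟩
  rw [hset, Set.ncard_union_eq, Set.ncard_image_of_injective _ (consVertex_injective _),
    Set.ncard_image_of_injective _ (consVertex_injective _),
    ncard_not_adj_isTree_sup_edge K hab]
  rw [Set.disjoint_left]
  rintro _ ⟨H, -, rfl⟩ ⟨H', -, h⟩
  exact hab ((consVertex_le_consVertex.1 (le_of_eq h)).2 (Set.mem_insert_of_mem a rfl)).symm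

lemma ncard_isTree_consVertex_pair_notMem (K : SimpleGraph (Fin m)) (hab : a ≠ b) :
    Set.ncard {T | T ≤ K.consVertex {a, b} ∧ T.IsTree ∧ s(0, a.succ) ∉ T.edgeSet} =
      Set.ncard {T | T ≤ K ∧ T.IsTree} := by
  have : NeZero m := ⟨by rintro rfl; exact a.elim0⟩
  have hset : {T | T ≤ K.consVertex {a, b} ∧ T.IsTree ∧ s(0, a.succ) ∉ T.edgeSet} =
      (fun H : SimpleGraph (Fin m) => H.consVertex {b}) '' {T | T ≤ K ∧ T.IsTree} := by
    ext T
    constructor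
    · rintro ⟨hle, ht, he⟩
      rw [← consVertex_comap_succ T] at hle ht he
      rw [← consVertex_comap_succ T]
      generalize T.comap Fin.succ = H at *
      generalize {j : Fin m | T.Adj 0 j.succ} = N at *
      obtain ⟨hH, hN⟩ := consVertex_le_consVertex.1 hle
      have ha : a ∉ N := he
      have hNb : N ⊆ {b} := fun j hj => by
        obtain rfl | rfl := hN hj
        · exact absurd hj ha
        · rfl
      obtain rfl | rfl := Set.subset_singleton_iff_eq.1 hNb
      · exact absurd ht not_isTree_consVertex_empty
      · exact ⟨H, ⟨hH, isTree_consVertex_singleton.1 ht⟩, rfl⟩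
    · rintro ⟨H, ⟨hH, ht⟩, rfl⟩
      exact ⟨consVertex_le_consVertex.2 ⟨hH, by simp⟩, isTree_consVertex_singleton.2 ht,
        by simpa using hab⟩
  rw [hset, Set.ncard_image_of_injective _ (consVertex_injective _)]

lemma edgeFeasible_consVertex_pair {n : ℕ} (hm : m ≤ n) (K : SimpleGraph (Fin m))
    (hab : a ≠ b) :
    EdgeFeasible (n + 1)
      (Set.ncard {T | T ≤ K ∧ T.IsTree} +
        Set.ncard {T : SimpleGraph (Fin m) | T ≤ K ⊔ edge a b ∧ T.IsTree ∧ T.Adj a b})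
      (Set.ncard {T | T ≤ K ∧ T.IsTree}) :=
  ⟨m + 1, K.consVertex {a, b}, s(0, a.succ), by omega, by simp,
    (ncard_isTree_consVertex_pair_mem K hab).symm,
    (ncard_isTree_consVertex_pair_notMem K hab).symm⟩

end counting

lemma EdgeFeasible.parallel_path {n t u : ℕ} (h : EdgeFeasible n t u) :
    EdgeFeasible (n + 1) (2 * t + u) (t + u) := by
  obtain ⟨m, G, e, hm, he, rfl, rfl⟩ := h
  induction e with | _ a b
  have hadj : G.Adj a b := he
  have h := edgeFeasible_consVertex_pair hm G hadj.ne
  have hsum : Set.ncard {T | T ≤ G ∧ T.IsTree} =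
      Set.ncard {T | T ≤ G ∧ T.IsTree ∧ s(a, b) ∈ T.edgeSet} +
      Set.ncard {T | T ≤ G ∧ T.IsTree ∧ s(a, b) ∉ T.edgeSet} := by
    rw [← Set.ncard_union_eq]
    · congr 1
      ext T
      simp only [Set.mem_ofPred_eq, Set.mem_union]
      tauto
    · rw [Set.disjoint_left]
      exact fun T h h' => h'.2.2 h.2.2
  rw [sup_edge_of_adj _ hadj, hsum] at h
  simp only [mem_edgeSet] at h ⊢
  convert h using 1
  ring

lemma EdgeFeasible.subdivide {n t u : ℕ} (h : EdgeFeasible n t u) :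
    EdgeFeasible (n + 1) (t + u) u := by
  obtain ⟨m, G, e, hm, he, rfl, rfl⟩ := h
  induction e with | _ a b
  have hadj : G.Adj a b := he
  have h := edgeFeasible_consVertex_pair hm (G \ edge a b) hadj.ne
  have hset : {T | T ≤ G \ edge a b ∧ T.IsTree} =
      {T | T ≤ G ∧ T.IsTree ∧ s(a, b) ∉ T.edgeSet} := by
    ext T
    simp only [Set.mem_ofPred_eq, le_sdiff, disjoint_edge, mem_edgeSet]
    tauto
  rw [sdiff_sup_cancel ((edge_le_iff _).2 (Or.inr hadj)), hset] at h
  rw [add_comm (Set.ncard _)]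
  exact h

lemma edgeFeasible_two : EdgeFeasible 2 1 0 := by
  refine ⟨2, ⊤, s(0, 1), le_rfl, by simp, ?_, ?_⟩
  · symm
    rw [Set.ncard_eq_one]
    refine ⟨⊤, Set.eq_singleton_iff_unique_mem.2 ⟨⟨le_rfl, ?_, by simp⟩, ?_⟩⟩
    · rw [isTree_iff_connected_and_card]
      refine ⟨connected_top, ?_⟩
      rw [Nat.card_eq_fintype_card, ← edgeFinset_card, card_edgeFinset_top_eq_card_choose_two]
      simp
    · rintro T ⟨-, -, h⟩
      have h : T.Adj 0 1 := h
      ext x y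
      fin_cases x <;> fin_cases y <;> simp [h, h.symm]
  · symm
    rw [Set.ncard_eq_zero, Set.eq_empty_iff_forall_notMem]
    rintro T ⟨-, ht, h⟩
    obtain ⟨x, hx⟩ := ht.connected.preconnected.exists_adj_of_nontrivial 0
    fin_cases x
    · simp at hx
    · exact h hx

lemma finite_edgeFeasible (n : ℕ) : {p : ℕ × ℕ | EdgeFeasible n p.1 p.2}.Finite := by
  refine ((Set.finite_Iic n).biUnion fun m _ => Set.finite_range
    fun q : SimpleGraph (Fin m) × Sym2 (Fin m) =>
      (Set.ncard {T | T ≤ q.1 ∧ T.IsTree ∧ q.2 ∈ T.edgeSet},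
        Set.ncard {T | T ≤ q.1 ∧ T.IsTree ∧ q.2 ∉ T.edgeSet})).subset ?_
  rintro ⟨t, u⟩ ⟨m, G, e, hm, -, ht, hu⟩
  exact Set.mem_biUnion (Set.mem_Iic.2 hm) ⟨(G, e), Prod.ext ht.symm hu.symm⟩

lemma exists_finset_edgeFeasible (n : ℕ) : ∃ S : Finset (ℕ × ℕ), S.card = 2 ^ n ∧
    ∀ p ∈ S, p.2 < p.1 ∧ EdgeFeasible (n + 2) p.1 p.2 := by
  induction n with
  | zero => exact ⟨{(1, 0)}, by simp, by simpa using edgeFeasible_two⟩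
  | succ n ih =>
    obtain ⟨S, hcard, hS⟩ := ih
    let A : ℕ × ℕ → ℕ × ℕ := fun p => (2 * p.1 + p.2, p.1 + p.2)
    let B : ℕ × ℕ → ℕ × ℕ := fun p => (p.1 + p.2, p.2)
    have hA : Function.Injective A := by
      rintro ⟨t, u⟩ ⟨t', u'⟩ h
      simp only [A, Prod.mk.injEq] at h ⊢
      omega
    have hB : Function.Injective B := by
      rintro ⟨t, u⟩ ⟨t', u'⟩ h
      simp only [B, Prod.mk.injEq] at h ⊢
      omega
    have hdisj : Disjoint (S.image A) (S.image B) := by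
      rw [Finset.disjoint_left]
      intro p hp hq
      obtain ⟨p, -, rfl⟩ := Finset.mem_image.1 hp
      obtain ⟨q, hq, h⟩ := Finset.mem_image.1 hq
      have := (hS q hq).1
      simp only [A, B, Prod.mk.injEq] at h
      omega
    refine ⟨S.image A ∪ S.image B, ?_, fun p hp => ?_⟩
    · rw [Finset.card_union_of_disjoint hdisj, Finset.card_image_of_injective _ hA,
        Finset.card_image_of_injective _ hB, hcard, pow_succ]
      ring
    · obtain hp | hp := Finset.mem_union.1 hp
      · obtain ⟨q, hq, rfl⟩ := Finset.mem_image.1 hp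
        have := hS q hq
        exact ⟨by simp only [A]; omega, this.2.parallel_path⟩
      · obtain ⟨q, hq, rfl⟩ := Finset.mem_image.1 hp
        have := hS q hq
        exact ⟨by simp only [B]; omega, this.2.subdivide⟩

/-- For every positive integer `n`, there are at least `2^n` distinct
`(n+2)`-feasible pairs. -/
theorem many_feasible_pairs (n : ℕ) (hn : 0 < n) :
    2 ^ n ≤ Set.ncard {p : ℕ × ℕ | EdgeFeasible (n + 2) p.1 p.2} := by
  obtain ⟨S, hcard, hS⟩ := exists_finset_edgeFeasible n
  rw [← hcard, ← Set.ncard_coe_finset]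
  exact Set.ncard_le_ncard (fun p hp => (hS p hp).2) (finite_edgeFeasible _)
end
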